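/- Let Ext: 𝔽₂^d × 𝔽₂^n → 𝔽₂^m be a linear strong seeded (k,ε)-extractor such that Ext(z,·) is surjective for every seed z. Let W: 𝔽₂^n → 𝔽₂^t be a linear map with t ≤ n−k, let 𝒟 be the uniform distribution on the image W(𝔽₂^n), and let (Z,Y) be uniformly distributed on 𝔽₂^d × 𝔽₂^n. Then for every s ∈ 𝔽₂^m, the conditional distribution of the pair (Z, W(Y)) given the event {Ext(Z,Y) = s} is 4ε-close in statistical distance to the product distribution U_d × 𝒟, where U_d is uniform on 𝔽₂^d. -/

import Mathlib

/-- The probability, over a uniformly random sample `ω : Ω`, that `X ω = a`. -/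
noncomputable def prob {Ω α : Type*} (X : Ω → α) (a : α) : ℝ :=
  (Nat.card {ω : Ω // X ω = a} : ℝ) / (Nat.card Ω : ℝ)

/-- Statistical distance between the distributions of `X` and `Y` (coins uniform). -/
noncomputable def SD {Ω₁ Ω₂ α : Type*} [Fintype α] (X : Ω₁ → α) (Y : Ω₂ → α) : ℝ :=
  (1 / 2 : ℝ) * ∑ a : α, |prob X a - prob Y a|

/-- The conditional probability `Pr[X = a | E]` for `ω` uniform on `Ω`. -/
noncomputable def cprob {Ω α : Type*} (X : Ω → α) (a : α) (E : Set Ω) : ℝ :=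
  (Nat.card {ω : Ω // ω ∈ E ∧ X ω = a} : ℝ) / (Nat.card E : ℝ)

/-- `Ext` is a strong seeded `(k,ε)`-extractor. -/
def IsStrongSeededExtractor {d n m : ℕ}
    (Ext : (Fin d → ZMod 2) → (Fin n → ZMod 2) → (Fin m → ZMod 2)) (k : ℕ) (ε : ℝ) : Prop :=
  ∀ (Ω : Type) [Fintype Ω] [Nonempty Ω], ∀ X : Ω → (Fin n → ZMod 2),
    (∀ x, prob X x ≤ ((2 : ℝ) ^ k)⁻¹) →
    SD (fun p : (Fin d → ZMod 2) × Ω => (p.1, Ext p.1 (X p.2)))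
       (id : (Fin d → ZMod 2) × (Fin m → ZMod 2) → (Fin d → ZMod 2) × (Fin m → ZMod 2)) ≤ ε

section Fibers

variable {V U T : Type*} [AddCommGroup V] [AddCommGroup U] [AddCommGroup T]

/-- Number of `y` with `E y = u` and `W y = w`. -/
noncomputable def jointFiberCard (E : V →+ U) (W : V →+ T) (u : U) (w : T) : ℝ :=
  (Nat.card {y : V // E y = u ∧ W y = w} : ℝ)

/-- Number of `y` with `W y = w`. -/
noncomputable def fiberCard (W : V →+ T) (w : T) : ℝ :=
  (Nat.card {y : V // W y = w} : ℝ)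

lemma jointFiberCard_add (E : V →+ U) (W : V →+ T) (u : U) (w : T) (v : V) :
    jointFiberCard E W (u + E v) (w + W v) = jointFiberCard E W u w := by
  unfold jointFiberCard
  congr 1
  exact (Nat.card_congr ((Equiv.addRight v).subtypeEquiv fun y => by simp)).symm

lemma fiberCard_add (W : V →+ T) (w : T) (v : V) :
    fiberCard W (w + W v) = fiberCard W w := by
  unfold fiberCard
  congr 1
  exact (Nat.card_congr ((Equiv.addRight v).subtypeEquiv fun y => by simp)).symm

lemma fiberCard_zero_pos [Finite V] (W : V →+ T) : 0 < fiberCard W 0 := by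
  unfold fiberCard
  have : Nonempty {y : V // W y = 0} := ⟨⟨0, map_zero W⟩⟩
  exact_mod_cast Nat.card_pos

lemma sum_fiberCard [Finite V] [Fintype T] (W : V →+ T) :
    ∑ w, fiberCard W w = (Nat.card V : ℝ) := by
  unfold fiberCard
  rw [← Nat.card_congr (Equiv.sigmaFiberEquiv W), Nat.card_sigma]
  push_cast
  rfl

lemma fiberCard_eq_zero (W : V →+ T) {w : T} (hw : w ∉ Set.range W) :
    fiberCard W w = 0 := by
  unfold fiberCard
  have : IsEmpty {y : V // W y = w} := ⟨fun y => hw ⟨y.1, y.2⟩⟩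
  simp

lemma jointFiberCard_eq_zero (E : V →+ U) (W : V →+ T) (u : U) {w : T}
    (hw : w ∉ Set.range W) : jointFiberCard E W u w = 0 := by
  unfold jointFiberCard
  have : IsEmpty {y : V // E y = u ∧ W y = w} := ⟨fun y => hw ⟨y.1, y.2.2⟩⟩
  simp

lemma fiberCard_le_zero_fiber [Finite V] (W : V →+ T) (w : T) :
    fiberCard W w ≤ fiberCard W 0 := by
  by_cases hw : w ∈ Set.range W
  · obtain ⟨v, rfl⟩ := hw
    simpa using (fiberCard_add W 0 v).le
  · rw [fiberCard_eq_zero W hw]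
    exact (fiberCard_zero_pos W).le

lemma card_mul_fiberCard_of_surjective [Finite V] [Fintype U] (E : V →+ U)
    (hE : Function.Surjective E) (s : U) :
    (Nat.card U : ℝ) * fiberCard E s = (Nat.card V : ℝ) := by
  have h : ∀ u, fiberCard E u = fiberCard E s := fun u => by
    obtain ⟨v, hv⟩ := hE (u - s)
    rw [← fiberCard_add E s v, hv, add_sub_cancel]
  rw [← sum_fiberCard E, Finset.sum_congr rfl fun u _ => h u]
  simp

/-- The deviation of `W` from uniform on a fibre of `E` matches the deviation of `E` from
uniform on the kernel of `W`. -/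
lemma sum_deviation_exchange [Finite V] [Fintype U] [Fintype T] (E : V →+ U) (W : V →+ T)
    (hE : Function.Surjective E) (s : U) :
    (Nat.card U : ℝ) * fiberCard W 0 *
        ∑ w, |(Nat.card U : ℝ) * jointFiberCard E W s w - fiberCard W w| =
      (Nat.card V : ℝ) * ∑ u, |(Nat.card U : ℝ) * jointFiberCard E W u 0 - fiberCard W 0| := by
  set g : U → T → ℝ := fun u w => |(Nat.card U : ℝ) * jointFiberCard E W u w - fiberCard W w|
    with hg
  have shift : ∀ u w v, g (u + E v) (w + W v) = g u w := fun u w v => by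
    simp only [hg, jointFiberCard_add, fiberCard_add]
  have row : ∀ u, ∑ w, g u w = ∑ w, g s w := fun u => by
    obtain ⟨v, hv⟩ := hE (u - s)
    rw [← Equiv.sum_comp (Equiv.addRight (W v))]
    refine Finset.sum_congr rfl fun w _ => ?_
    rw [← shift s w v, hv, add_sub_cancel]
    rfl
  have col : ∀ w, fiberCard W w * ∑ u, g u 0 = fiberCard W 0 * ∑ u, g u w := fun w => by
    by_cases hw : w ∈ Set.range W
    · obtain ⟨v, rfl⟩ := hw
      have hf : fiberCard W (W v) = fiberCard W 0 := by simpa using fiberCard_add W 0 v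
      rw [hf, ← Equiv.sum_comp (Equiv.addRight (E v)) fun u => g u (W v)]
      congr 1
      refine Finset.sum_congr rfl fun u _ => ?_
      simpa using (shift u 0 v).symm
    · have h : ∀ u, g u w = 0 := fun u => by
        simp [hg, jointFiberCard_eq_zero E W u hw, fiberCard_eq_zero W hw]
      simp [fiberCard_eq_zero W hw, h]
  change _ * ∑ w, g s w = _ * ∑ u, g u 0
  calc (Nat.card U : ℝ) * fiberCard W 0 * ∑ w, g s w
      = fiberCard W 0 * ∑ u, ∑ w, g u w := by
        rw [Finset.sum_congr rfl fun u _ => row u]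
        simp
        ring
    _ = ∑ w, fiberCard W w * ∑ u, g u 0 := by
        rw [Finset.sum_comm, Finset.mul_sum]
        exact Finset.sum_congr rfl fun w _ => (col w).symm
    _ = _ := by rw [← Finset.sum_mul, sum_fiberCard]

end Fibers

lemma prob_addMonoidHom {V T : Type*} [AddCommGroup V] [AddCommGroup T] (W : V →+ T) (w : T) :
    prob W w = fiberCard W w / (Nat.card V : ℝ) := rfl

section Seeded

variable {S V U T : Type*} [AddCommGroup V] [AddCommGroup U] [AddCommGroup T]

lemma cprob_seeded [Finite S] [Finite V] [Fintype U] (E : S → V →+ U) (W : V →+ T)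
    (hE : ∀ z, Function.Surjective (E z)) (s : U) (z : S) (w : T) :
    cprob (fun p : S × V => (p.1, W p.2)) (z, w) {p : S × V | E p.1 p.2 = s} =
      (Nat.card U : ℝ) * jointFiberCard (E z) W s w / (Nat.card S * Nat.card V) := by
  have : Fintype S := Fintype.ofFinite S
  have hU : (Nat.card U : ℝ) ≠ 0 := by exact_mod_cast Nat.card_pos.ne'
  have hnum : (Nat.card {p : S × V // p ∈ {p : S × V | E p.1 p.2 = s} ∧ (p.1, W p.2) = (z, w)} : ℝ)
      = jointFiberCard (E z) W s w := by
    unfold jointFiberCard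
    congr 1
    refine Nat.card_congr
      ⟨fun p => ⟨p.1.2, ?_⟩, fun y => ⟨(z, y.1), y.2.1, by simp [y.2.2]⟩, ?_, fun y => rfl⟩
    · obtain ⟨⟨a, b⟩, h1, h2⟩ := p
      obtain ⟨rfl, rfl⟩ := Prod.mk.inj h2
      exact ⟨h1, rfl⟩
    · rintro ⟨⟨a, b⟩, h1, h2⟩
      obtain ⟨rfl, rfl⟩ := Prod.mk.inj h2
      rfl
  have hden : (Nat.card U : ℝ) * (Nat.card {p : S × V | E p.1 p.2 = s} : ℝ)
      = Nat.card S * Nat.card V := by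
    have e : {p : S × V | E p.1 p.2 = s} ≃ Σ z, {y : V // E z y = s} :=
      ⟨fun p => ⟨p.1.1, p.1.2, p.2⟩, fun q => ⟨(q.1, q.2.1), q.2.2⟩, fun _ => rfl, fun _ => rfl⟩
    rw [Nat.card_congr e, Nat.card_sigma]
    push_cast
    change _ * ∑ z, fiberCard (E z) s = _
    rw [Finset.mul_sum,
      Finset.sum_congr rfl fun z _ => card_mul_fiberCard_of_surjective (E z) (hE z) s]
    simp
  rw [← hden, mul_div_mul_left _ _ hU, cprob, hnum]

lemma prob_seeded_ker [Finite S] [Finite V] (E : S → V →+ U) (W : V →+ T) (z : S) (u : U) :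
    prob (fun p : S × {y : V // W y = 0} => (p.1, E p.1 p.2.1)) (z, u) =
      jointFiberCard (E z) W u 0 / (Nat.card S * fiberCard W 0) := by
  unfold prob jointFiberCard fiberCard
  rw [Nat.card_prod, Nat.cast_mul]
  congr 2
  refine Nat.card_congr
    ⟨fun p => ⟨p.1.2.1, ?_, p.1.2.2⟩, fun y => ⟨(z, ⟨y.1, y.2.2⟩), by simp [y.2.1]⟩, ?_,
      fun y => rfl⟩
  · obtain ⟨⟨a, b⟩, h⟩ := p
    obtain ⟨rfl, rfl⟩ := Prod.mk.inj h
    rfl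
  · rintro ⟨⟨a, b⟩, h⟩
    obtain ⟨rfl, rfl⟩ := Prod.mk.inj h
    rfl

lemma prob_id {α : Type*} (a : α) : prob (id : α → α) a = (Nat.card α : ℝ)⁻¹ := by
  simp [prob]

/-- The distance of `(Z, W Y)` given `E Z Y = s` from its ideal distribution equals the distance
of `(Z, E Z X)` from uniform, for `X` uniform on the kernel of `W`. -/
lemma leakage_distance_eq_SD [Fintype S] [Nonempty S] [Finite V] [Fintype U] [Fintype T]
    (E : S → V →+ U) (W : V →+ T) (hE : ∀ z, Function.Surjective (E z)) (s : U) :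
    (1 / 2 : ℝ) * ∑ zw : S × T,
        |cprob (fun p : S × V => (p.1, W p.2)) zw {p : S × V | E p.1 p.2 = s} -
          (Nat.card S : ℝ)⁻¹ * prob W zw.2| =
      SD (fun p : S × {y : V // W y = 0} => (p.1, E p.1 p.2.1)) (id : S × U → S × U) := by
  have hU : (0 : ℝ) < Nat.card U := by exact_mod_cast Nat.card_pos
  have hV : (0 : ℝ) < Nat.card V := by exact_mod_cast Nat.card_pos
  have hS : (0 : ℝ) < Nat.card S := by exact_mod_cast Nat.card_pos
  have hW := fiberCard_zero_pos W
  unfold SD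
  rw [Fintype.sum_prod_type, Fintype.sum_prod_type]
  congr 1
  refine Finset.sum_congr rfl fun z _ => ?_
  have hl : ∀ w, |cprob (fun p : S × V => (p.1, W p.2)) (z, w) {p : S × V | E p.1 p.2 = s} -
        (Nat.card S : ℝ)⁻¹ * prob W w| =
      (Nat.card S * Nat.card V : ℝ)⁻¹ *
        |(Nat.card U : ℝ) * jointFiberCard (E z) W s w - fiberCard W w| := fun w => by
    rw [cprob_seeded E W hE, prob_addMonoidHom,
      ← abs_of_pos (inv_pos.2 (mul_pos hS hV)), ← abs_mul]
    congr 1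
    field_simp
  have hr : ∀ u, |prob (fun p : S × {y : V // W y = 0} => (p.1, E p.1 p.2.1)) (z, u) -
        prob (id : S × U → S × U) (z, u)| =
      (Nat.card S * (Nat.card U * fiberCard W 0) : ℝ)⁻¹ *
        |(Nat.card U : ℝ) * jointFiberCard (E z) W u 0 - fiberCard W 0| := fun u => by
    have hpos := inv_pos.2 (mul_pos hS (mul_pos hU hW))
    rw [prob_seeded_ker, prob_id, Nat.card_prod, ← abs_of_pos hpos, ← abs_mul]
    congr 1
    push_cast
    field_simp
  simp only [hl, hr, ← Finset.mul_sum]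
  have key := sum_deviation_exchange (E z) W (hE z) s
  field_simp
  linear_combination key

end Seeded

/-- for `(Z,Y)` uniform on `𝔽₂^d × 𝔽₂^n` and any `s`, the conditional
distribution of `(Z, W(Y))` given `{Ext(Z,Y) = s}` is `4ε`-close in statistical
distance to `U_d × 𝒟`, where `𝒟` is the uniform distribution on the image of `W`,
which (since the fibers of the linear map `W` over its image have equal size) assigns
to `w` the probability `prob (W ∘ U_n) w`. -/
theorem stmt_3 (d n m k t : ℕ) (ε : ℝ)
    (Ext : (Fin d → ZMod 2) → (Fin n → ZMod 2) → (Fin m → ZMod 2))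
    (hlin : ∀ z, IsLinearMap (ZMod 2) (Ext z))
    (hext : IsStrongSeededExtractor Ext k ε)
    (hsurj : ∀ z, Function.Surjective (Ext z))
    (W : (Fin n → ZMod 2) →ₗ[ZMod 2] (Fin t → ZMod 2))
    (ht : t + k ≤ n)
    (s : Fin m → ZMod 2) :
    (1 / 2 : ℝ) * ∑ zw : (Fin d → ZMod 2) × (Fin t → ZMod 2),
        |cprob (fun p : (Fin d → ZMod 2) × (Fin n → ZMod 2) => (p.1, W p.2)) zw
            {p : (Fin d → ZMod 2) × (Fin n → ZMod 2) | Ext p.1 p.2 = s} -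
          ((2 : ℝ) ^ d)⁻¹ * prob (fun x : Fin n → ZMod 2 => W x) zw.2| ≤ 4 * ε := by
  let E : (Fin d → ZMod 2) → (Fin n → ZMod 2) →+ (Fin m → ZMod 2) :=
    fun z => ((hlin z).mk' (Ext z)).toAddMonoidHom
  let W' : (Fin n → ZMod 2) →+ (Fin t → ZMod 2) := W.toAddMonoidHom
  let K := {y : Fin n → ZMod 2 // W' y = 0}
  have hK : Nonempty K := ⟨⟨0, map_zero W'⟩⟩
  have : Fintype K := Fintype.ofFinite K
  have hcard : ∀ r : ℕ, (Nat.card (Fin r → ZMod 2) : ℝ) = 2 ^ r := fun r => by simp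
  have hker : (2 : ℝ) ^ k ≤ Nat.card K := by
    have h : (2 : ℝ) ^ n ≤ 2 ^ t * fiberCard W' 0 := by
      rw [← hcard n, ← sum_fiberCard W']
      refine (Finset.sum_le_sum fun w _ => fiberCard_le_zero_fiber W' w).trans_eq ?_
      simp
    have h' : (2 : ℝ) ^ (t + k) ≤ 2 ^ n := pow_le_pow_right₀ one_le_two ht
    rw [pow_add] at h'
    exact le_of_mul_le_mul_left (h'.trans h) (by positivity)
  have hsource : ∀ x, prob (Subtype.val : K → Fin n → ZMod 2) x ≤ ((2 : ℝ) ^ k)⁻¹ := fun x => by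
    have hsub : Subsingleton {ω : K // ω.1 = x} :=
      ⟨fun a b => Subtype.ext (Subtype.ext (a.2.trans b.2.symm))⟩
    have h1 : (Nat.card {ω : K // ω.1 = x} : ℝ) ≤ 1 := by
      exact_mod_cast Finite.card_le_one_iff_subsingleton.2 hsub
    calc prob (Subtype.val : K → Fin n → ZMod 2) x ≤ 1 / (Nat.card K : ℝ) := by
          unfold prob
          gcongr
      _ ≤ ((2 : ℝ) ^ k)⁻¹ := by
          rw [one_div]
          gcongr
  have hSD := hext K Subtype.val hsource
  have heq := leakage_distance_eq_SD E W' hsurj s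
  rw [hcard d] at heq
  have hle := heq.trans_le hSD
  have hε : 0 ≤ ε := le_trans (by unfold SD; positivity) hSD
  exact hle.trans (by linarith)
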